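/- There exists a constant c > 0 such that for every integer d ≥ 3, every n ≥ 1, and every function v : {1,…,d}^{2n} → ℝ that vanishes on every word that is not fully reducible and satisfies Σ_{w fully reducible} v(w) = 0, one has ⟨v, H v⟩ ≥ (c / (d · n^{15/2})) · Σ_w v(w)². In other words, the spectral gap of the pair-flip Hamiltonian on a chain of length 2n restricted to the fully reducible subspace is Ω(1/(n^{15/2} d)). -/

import Mathlib

open scoped Classical

/-- One step of the stack-based reduction: push the letter if the stack is empty or
its top differs from the current letter, otherwise pop the top. -/
def redStep {d : ℕ} (s : List (Fin d)) (a : Fin d) : List (Fin d) :=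
  match s with
  | [] => [a]
  | b :: rest => if a = b then rest else a :: b :: rest

/-- The irreducible string of a word: the final stack content read from bottom to top. -/
def irrOf {d N : ℕ} (w : Fin N → Fin d) : List (Fin d) :=
  ((List.ofFn w).foldl redStep []).reverse

/-- A word is fully reducible if its irreducible string is empty. -/
def FullyReducible {d N : ℕ} (w : Fin N → Fin d) : Prop := irrOf w = []

/-- The word `w` with the letters at positions `i` and `i+1` both replaced by `t'`. -/
def flipAt {d N : ℕ} (w : Fin N → Fin d) (i : ℕ) (t' : Fin d) : Fin N → Fin d :=
  fun p => if (p : ℕ) = i ∨ (p : ℕ) = i + 1 then t' else w p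

/-- The letters of `w` at positions `i` and `i+1` both equal `t`. -/
def hasPair {d N : ℕ} (w : Fin N → Fin d) (i : ℕ) (t : Fin d) : Prop :=
  ∀ p : Fin N, ((p : ℕ) = i ∨ (p : ℕ) = i + 1) → w p = t

/-- The quadratic form ⟨v, H v⟩ of the pair-flip Hamiltonian on a chain of length `N`:
`∑_{i=1}^{N−1} ∑_{t < t'} ∑_{w : w_i = w_{i+1} = t} (v(w) − v(w^{(i; t→t')}))²`. -/
noncomputable def quadForm (d N : ℕ) (v : (Fin N → Fin d) → ℝ) : ℝ :=
  ∑ i ∈ Finset.range (N - 1), ∑ t : Fin d, ∑ t' : Fin d,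
    if t < t' then
      (∑ w : Fin N → Fin d,
        if hasPair w i t then (v w - v (flipAt w i t')) ^ 2 else 0)
    else 0

section Sequences

variable (b W : ℕ → ℝ) (m : ℝ)

/-- Hypotheses on the counting sequences. -/
structure SeqHyp : Prop where
  hm : 1 ≤ m
  b0 : b 0 = 1
  W0 : W 0 = 1
  bpos : ∀ n, 0 < b n
  Wpos : ∀ n, 0 < W n
  hb : ∀ n, b (n + 1) = m * ∑ p ∈ Finset.HasAntidiagonal.antidiagonal n, b p.1 * b p.2
  hW : ∀ n, W (n + 1) = (m + 1) * ∑ p ∈ Finset.HasAntidiagonal.antidiagonal n, b p.1 * W p.2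
  hc : ∀ n : ℕ, ((n : ℝ) + 2) * b (n + 1) = m * (4 * n + 2) * b n

variable {b W m}

lemma SeqHyp.blc (h : SeqHyp b W m) {k n : ℕ} (hkn : k ≤ n) :
    b (k + 1) * b n ≤ b k * b (n + 1) := by
  have h1 := h.hc k
  have h2 := h.hc n
  have hk : b (k + 1) = m * (4 * k + 2) * b k / ((k : ℝ) + 2) := by
    field_simp; linarith
  have hn : b (n + 1) = m * (4 * n + 2) * b n / ((n : ℝ) + 2) := by
    field_simp; linarith
  have hr : (4 * (k : ℝ) + 2) / ((k : ℝ) + 2) ≤ (4 * (n : ℝ) + 2) / ((n : ℝ) + 2) := by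
    rw [div_le_div_iff₀ (by positivity) (by positivity)]
    have : (k : ℝ) ≤ n := by exact_mod_cast hkn
    nlinarith
  have hp : 0 ≤ m * b k * b n :=
    mul_nonneg (mul_nonneg (by linarith [h.hm]) (h.bpos k).le) (h.bpos n).le
  calc b (k + 1) * b n = (m * b k * b n) * ((4 * (k : ℝ) + 2) / ((k : ℝ) + 2)) := by
        rw [hk]; ring
    _ ≤ (m * b k * b n) * ((4 * (n : ℝ) + 2) / ((n : ℝ) + 2)) :=
        mul_le_mul_of_nonneg_left hr hp
    _ = b k * b (n + 1) := by rw [hn]; ring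

lemma SeqHyp.step (h : SeqHyp b W m) (n : ℕ) (ih : ∀ i ≤ n, W i * b n ≤ W n * b i) :
    W n * b (n + 1) ≤ W (n + 1) * b n := by
  have hm := h.hm
  rcases n with _ | n
  · have e1 := h.hb 0
    have e2 := h.hW 0
    simp [h.b0, h.W0] at e1 e2
    simp [e1, e2, h.b0, h.W0]
  · have e1 := h.hb (n + 1)
    have e2 := h.hW (n + 1)
    rw [Finset.Nat.sum_antidiagonal_succ] at e1 e2
    simp only [h.b0, one_mul] at e1 e2
    have f1 := h.hb n
    have f2 := h.hW n
    have hbn := h.bpos (n + 1)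
    have hWn := h.Wpos (n + 1)
    set A := ∑ p ∈ Finset.HasAntidiagonal.antidiagonal n, b p.1 * b p.2 with hA
    set B := ∑ p ∈ Finset.HasAntidiagonal.antidiagonal n, b p.1 * W p.2 with hB
    set A' := ∑ p ∈ Finset.HasAntidiagonal.antidiagonal n, b (p.1 + 1) * b p.2 with hA'
    set B' := ∑ p ∈ Finset.HasAntidiagonal.antidiagonal n, b (p.1 + 1) * W p.2 with hB'
    have key : (b (n + 1 + 1) * B - b (n + 1) * B') * b (n + 1) ≤
        W (n + 1) * (b (n + 1 + 1) * A - b (n + 1) * A') := by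
      rw [hA, hB, hA', hB', Finset.mul_sum, Finset.mul_sum, Finset.mul_sum, Finset.mul_sum,
        ← Finset.sum_sub_distrib, ← Finset.sum_sub_distrib, Finset.sum_mul, Finset.mul_sum]
      apply Finset.sum_le_sum
      rintro ⟨i, j⟩ hij
      have hij' : i + j = n := by simpa using hij
      have c1 : b (i + 1) * b (n + 1) ≤ b i * b (n + 1 + 1) := h.blc (by omega)
      have c2 := ih j (by omega)
      have := mul_le_mul_of_nonneg_left c2 (sub_nonneg.2 c1)
      simp only
      nlinarith
    have g : b (n + 1 + 1) * A - b (n + 1) * A' = b (n + 1) * b (n + 1) := by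
      have hm0 : m ≠ 0 := by linarith
      apply mul_left_cancel₀ hm0
      have : m * (b (n + 1 + 1) * A) = b (n + 1 + 1) * b (n + 1) := by rw [f1]; ring
      have e1' : m * A' = b (n + 1 + 1) - m * b (n + 1) := by rw [e1]; ring
      calc m * (b (n + 1 + 1) * A - b (n + 1) * A')
          = m * (b (n + 1 + 1) * A) - b (n + 1) * (m * A') := by ring
        _ = _ := by rw [this, e1']; ring
    rw [g] at key
    have key2 : b (n + 1 + 1) * B - b (n + 1) * B' ≤ W (n + 1) * b (n + 1) := by
      have : (b (n + 1 + 1) * B - b (n + 1) * B') * b (n + 1) ≤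
        (W (n + 1) * b (n + 1)) * b (n + 1) := by linarith
      exact le_of_mul_le_mul_right this hbn
    have hm1 : 0 ≤ m + 1 := by linarith
    have key3 := mul_le_mul_of_nonneg_left key2 hm1
    calc W (n + 1) * b (n + 1 + 1) = (m + 1) * (b (n + 1 + 1) * B) := by rw [f2]; ring
      _ ≤ (m + 1) * (W (n + 1) * b (n + 1)) + (m + 1) * (b (n + 1) * B') := by linarith
      _ = W (n + 1 + 1) * b (n + 1) := by rw [e2]; ring

lemma SeqHyp.mono (h : SeqHyp b W m) (n : ℕ) : ∀ i ≤ n, W i * b n ≤ W n * b i := by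
  induction n with
  | zero => intro i hi; obtain rfl : i = 0 := by omega
            exact le_refl _
  | succ n ih =>
    intro i hi
    rcases Nat.lt_or_ge n i with h1 | h1
    · obtain rfl : i = n + 1 := by omega
      exact le_refl _
    · have s := h.step n ih
      have t := ih i h1
      have hbn := h.bpos n
      have : (W i * b (n + 1)) * b n ≤ (W (n + 1) * b i) * b n := by
        have u1 := mul_le_mul_of_nonneg_right t (h.bpos (n + 1)).le
        have u2 := mul_le_mul_of_nonneg_right s (h.bpos i).le
        linarith
      exact le_of_mul_le_mul_right this hbn

lemma SeqHyp.rec2 (h : SeqHyp b W m) (n : ℕ) :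
    W (n + 1) = (m + 1) ^ 2 * W n - (m + 1) * m * b n := by
  induction n using Nat.strong_induction_on with
  | _ n ih =>
    rcases n with _ | n
    · have e2 := h.hW 0
      simp [h.b0, h.W0] at e2
      simp [e2, h.b0, h.W0]; ring
    · have e2 := h.hW (n + 1)
      rw [Finset.Nat.sum_antidiagonal_succ'] at e2
      have : ∑ p ∈ Finset.HasAntidiagonal.antidiagonal n, b p.1 * W (p.2 + 1) =
          (m + 1) ^ 2 * (∑ p ∈ Finset.HasAntidiagonal.antidiagonal n, b p.1 * W p.2) -
          (m + 1) * m * ∑ p ∈ Finset.HasAntidiagonal.antidiagonal n, b p.1 * b p.2 := by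
        rw [Finset.mul_sum, Finset.mul_sum, ← Finset.sum_sub_distrib]
        apply Finset.sum_congr rfl
        rintro ⟨i, j⟩ hij
        have hij' : i + j = n := by simpa using hij
        simp only
        rw [ih j (by omega)]; ring
      rw [this] at e2
      have f1 := h.hb n
      have f2 := h.hW n
      simp only [h.W0] at e2
      rw [e2]
      linear_combination -(m+1)^2 * f2 + (m + 1) * (m + 1) * f1

lemma SeqHyp.Wlc (h : SeqHyp b W m) {k n : ℕ} (hkn : k ≤ n) :
    W (k + 1) * W n ≤ W k * W (n + 1) := by
  rw [h.rec2 k, h.rec2 n]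
  have := h.mono n k hkn
  have hm := h.hm
  have := mul_le_mul_of_nonneg_left this (show 0 ≤ (m + 1) * m by nlinarith)
  nlinarith

lemma SeqHyp.cross (h : SeqHyp b W m) {k n : ℕ} (hkn : k ≤ n) :
    b (k + 1) * W n ≤ b k * W (n + 1) := by
  have h1 := h.blc hkn
  have h2 := h.step n (h.mono n)
  have u1 := mul_le_mul_of_nonneg_right h1 (h.Wpos n).le
  have u2 := mul_le_mul_of_nonneg_right h2 (h.bpos k).le
  have : (b (k + 1) * W n) * b n ≤ (b k * W (n + 1)) * b n := by linarith
  exact le_of_mul_le_mul_right this (h.bpos n)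

lemma SeqHyp.psum (h : SeqHyp b W m) (n : ℕ) :
    ∑ i ∈ Finset.range n, b i / (4 * m) ^ i = 2 - 2 * ((n : ℝ) + 1) * (b n / (4 * m) ^ n) := by
  have hm : 0 < m := by linarith [h.hm]
  induction n with
  | zero => simp [h.b0]
  | succ n ih =>
    rw [Finset.sum_range_succ, ih]
    have := h.hc n
    have hb : b (n + 1) = m * (4 * n + 2) * b n / ((n : ℝ) + 2) := by
      field_simp; linarith
    rw [hb]
    push_cast
    rw [pow_succ]
    field_simp
    ring

lemma SeqHyp.upper (h : SeqHyp b W m) (n : ℕ) : W n ≤ (4 * m) ^ n := by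
  have hm : 0 < m := by linarith [h.hm]
  induction n using Nat.strong_induction_on with
  | _ n ih =>
    rcases n with _ | n
    · simp [h.W0]
    · rw [h.hW n]
      have h1 : ∑ p ∈ Finset.HasAntidiagonal.antidiagonal n, b p.1 * W p.2 ≤
          ∑ p ∈ Finset.HasAntidiagonal.antidiagonal n, (4 * m) ^ n * (b p.1 / (4 * m) ^ p.1) := by
        apply Finset.sum_le_sum
        rintro ⟨i, j⟩ hij
        have hij' : i + j = n := by simpa using hij
        simp only
        have := mul_le_mul_of_nonneg_left (ih j (by omega)) (h.bpos i).le
        refine this.trans (le_of_eq ?_)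
        rw [← hij', pow_add]
        field_simp
      rw [← Finset.mul_sum, Finset.Nat.sum_antidiagonal_eq_sum_range_succ_mk
        (f := fun p : ℕ × ℕ => b p.1 / (4 * m) ^ p.1)] at h1
      simp only [Nat.succ_eq_add_one] at h1
      rw [h.psum (n + 1)] at h1
      have hp : 0 ≤ 2 * (((n + 1 : ℕ) : ℝ) + 1) * (b (n + 1) / (4 * m) ^ (n + 1)) := by
        have := h.bpos (n + 1)
        positivity
      have hq : 0 < (4 * m) ^ n := by positivity
      have h2 : ∑ p ∈ Finset.HasAntidiagonal.antidiagonal n, b p.1 * W p.2 ≤ (4 * m) ^ n * 2 :=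
        h1.trans (mul_le_mul_of_nonneg_left (by linarith) hq.le)
      have h3 := mul_le_mul_of_nonneg_left h2 (show 0 ≤ m + 1 by linarith)
      refine h3.trans ?_
      rw [pow_succ]
      have := h.hm
      nlinarith

lemma SeqHyp.blower (h : SeqHyp b W m) (n : ℕ) : (4 * m) ^ n ≤ ((n : ℝ) + 1) ^ 2 * b n := by
  have hm : 0 < m := by linarith [h.hm]
  induction n with
  | zero => simp [h.b0]
  | succ n ih =>
    have := h.hc n
    have hb : b (n + 1) = m * (4 * n + 2) * b n / ((n : ℝ) + 2) := by
      field_simp; linarith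
    rw [hb, pow_succ]
    push_cast
    have hbn := h.bpos n
    have e : ((n : ℝ) + 1 + 1) ^ 2 * (m * (4 * n + 2) * b n / ((n : ℝ) + 2)) =
        ((n : ℝ) + 2) * (4 * n + 2) * (m * b n) := by
      field_simp; ring
    rw [e]
    have h1 := mul_le_mul_of_nonneg_right ih (show 0 ≤ 4 * m by linarith)
    refine h1.trans ?_
    have hmb : 0 < m * b n := by positivity
    have : 4 * ((n : ℝ) + 1) ^ 2 ≤ ((n : ℝ) + 2) * (4 * n + 2) := by
      have : (0 : ℝ) ≤ n := by positivity
      nlinarith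
    nlinarith

lemma SeqHyp.Wlower (h : SeqHyp b W m) (n : ℕ) : (4 * m) ^ n ≤ ((n : ℝ) + 1) ^ 2 * W n := by
  have h1 := h.mono n 0 (Nat.zero_le _)
  rw [h.W0, h.b0] at h1
  have h2 := h.blower n
  have : ((n : ℝ) + 1) ^ 2 * b n ≤ ((n : ℝ) + 1) ^ 2 * W n :=
    mul_le_mul_of_nonneg_left (by linarith) (by positivity)
  linarith

/-- Existence of the splitting probabilities. -/
lemma exists_split (b N : ℕ → ℝ) (M : ℝ) (hM : 0 < M) (hb : ∀ n, 0 < b n) (hN : ∀ n, 0 < N n)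
    (hr : ∀ n, N (n + 1) = M * ∑ p ∈ Finset.HasAntidiagonal.antidiagonal n, b p.1 * N p.2)
    (lc : ∀ k n, k ≤ n → N (k + 1) * N n ≤ N k * N (n + 1))
    (cr : ∀ k n, k ≤ n → b (k + 1) * N n ≤ b k * N (n + 1)) :
    ∃ r : ℕ → ℕ → ℝ, (∀ k l, 0 ≤ r k l) ∧ (∀ k l, r k l ≤ 1) ∧ (∀ l, r 0 l = 0) ∧
      (∀ k, r (k + 1) 0 = 1) ∧
      ∀ k l, r (k + 1) l * (b (k + 1) / b k) + (1 - r k (l + 1)) * (N (l + 1) / N l) =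
        N (k + l + 2) / N (k + l + 1) := by
  set α : ℕ → ℕ → ℝ := fun k l => ∑ i ∈ Finset.range k,
    b i * (N (k + l - 1 - i) * (N (k + l + 1) / N (k + l)) - N (k + l - i)) with hα
  have α0 : ∀ l, α 0 l = 0 := by intro l; simp [hα]
  have αs : ∀ k l, α (k + 1) l = b k * (N l * (N (k + l + 2) / N (k + l + 1)) - N (l + 1))
      + α k (l + 1) := by
    intro k l
    simp only [hα]
    rw [Finset.sum_range_succ, add_comm]
    congr 1
    · have e1 : k + 1 + l - 1 - k = l := by omega
      have e2 : k + 1 + l - k = l + 1 := by omega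
      have e3 : k + 1 + l + 1 = k + l + 2 := by omega
      have e4 : k + 1 + l = k + l + 1 := by omega
      rw [e1, e2, e3, e4]
    · have e4 : k + (l + 1) = k + 1 + l := by omega
      rw [e4]
  have αn : ∀ k l, 0 ≤ α k l := by
    intro k
    induction k with
    | zero => intro l; rw [α0]
    | succ k ih =>
      intro l
      rw [αs]
      have h1 := lc l (k + l + 1) (by omega)
      have : N (l + 1) ≤ N l * (N (k + l + 2) / N (k + l + 1)) := by
        rw [← mul_div_assoc, le_div_iff₀ (hN _)]
        exact h1
      have h2 := mul_nonneg (hb k).le (sub_nonneg.2 this)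
      linarith [ih (l + 1)]
  have αe : ∀ k, α (k + 1) 0 = b (k + 1) * N 0 := by
    intro k
    have h1 := hr k
    have h2 := hr (k + 1)
    rw [Finset.Nat.sum_antidiagonal_succ', Finset.Nat.sum_antidiagonal_eq_sum_range_succ_mk] at h2
    rw [Finset.Nat.sum_antidiagonal_eq_sum_range_succ_mk] at h1
    simp only at h1 h2
    have e : α (k + 1) 0 = (N (k + 2) / N (k + 1)) * (∑ i ∈ Finset.range (k + 1), b i * N (k - i))
        - ∑ i ∈ Finset.range (k + 1), b i * N (k - i + 1) := by
      simp only [hα]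
      rw [Finset.mul_sum, ← Finset.sum_sub_distrib]
      apply Finset.sum_congr rfl
      intro i hi
      have hi' : i < k + 1 := by simpa using hi
      have e1 : k + 1 + 0 - 1 - i = k - i := by omega
      have e2 : k + 1 + 0 - i = k - i + 1 := by omega
      rw [e1, e2]
      simp only [add_zero]
      ring
    rw [e]
    have hk := hN (k + 1)
    set X := ∑ i ∈ Finset.range (k + 1), b i * N (k - i)
    set Y := ∑ i ∈ Finset.range (k + 1), b i * N (k - i + 1)
    have : N (k + 2) / N (k + 1) * X = N (k + 2) / M := by
      have : X = N (k + 1) / M := by rw [h1]; field_simp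
      rw [this]; field_simp
    rw [this]
    have h2' : N (k + 2) = M * (b (k + 1) * N 0 + Y) := h2
    rw [h2']; field_simp; ring
  have αu : ∀ l k, α k l ≤ b k * N l := by
    intro l
    induction l with
    | zero =>
      intro k
      rcases k with _ | k
      · rw [α0]; exact (mul_pos (hb _) (hN _)).le
      · rw [αe]
    | succ l ih =>
      intro k
      have h1 := αs k l
      have h2 := ih (k + 1)
      have h3 := cr k (k + l + 1) (by omega)
      have : b (k + 1) ≤ b k * (N (k + l + 2) / N (k + l + 1)) := by
        rw [← mul_div_assoc, le_div_iff₀ (hN _)]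
        exact h3
      have h4 := mul_le_mul_of_nonneg_right this (hN l).le
      nlinarith
  refine ⟨fun k l => α k l / (b k * N l), ?_, ?_, ?_, ?_, ?_⟩
  · intro k l
    exact div_nonneg (αn k l) (mul_pos (hb _) (hN _)).le
  · intro k l
    exact div_le_one_of_le₀ (αu l k) (mul_pos (hb _) (hN _)).le
  · intro l; simp [α0]
  · intro k
    simp only
    rw [αe, div_self (mul_pos (hb _) (hN _)).ne']
  · intro k l
    simp only
    rw [αs]
    have := hb k
    have := hb (k + 1)
    have := hN l
    have := hN (l + 1)
    have := hN (k + l + 1)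
    field_simp
    ring

end Sequences

/-- Plane trees with coloured edges, encoding closed walks on the regular tree. -/
inductive PT (d : ℕ) : Type
  | nil : PT d
  | node (a : Fin d) (u s : PT d) : PT d

namespace PT

/-- The word of a tree. -/
def wd {d : ℕ} : PT d → List (Fin d)
  | nil => []
  | node a u s => a :: (wd u ++ a :: wd s)

/-- The number of edges. -/
def size {d : ℕ} : PT d → ℕ
  | nil => 0
  | node _ u s => size u + size s + 1

/-- Properly coloured trees, with a forbidden colour at the root. -/
def Valid {d : ℕ} : PT d → Option (Fin d) → Prop
  | nil, _ => True
  | node a u s, o => some a ≠ o ∧ Valid u (some a) ∧ Valid s o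

lemma length_wd {d : ℕ} (t : PT d) : t.wd.length = 2 * t.size := by
  induction t with
  | nil => rfl
  | node a u s hu hs => simp [wd, size, hu, hs]; ring

lemma finite_size {d : ℕ} (n : ℕ) : {t : PT d | t.size ≤ n}.Finite := by
  induction n with
  | zero =>
    apply (Set.finite_singleton (nil : PT d)).subset
    intro t ht
    cases t with
    | nil => rfl
    | node a u s => simp [size] at ht
  | succ n ih =>
    have h2 : ((fun p : Fin d × PT d × PT d => node p.1 p.2.1 p.2.2) ''
      (Set.univ ×ˢ ({t : PT d | t.size ≤ n} ×ˢ {t : PT d | t.size ≤ n}))).Finite :=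
      (Set.finite_univ.prod (ih.prod ih)).image _
    apply ((Set.finite_singleton (nil : PT d)).union h2).subset
    intro t ht
    cases t with
    | nil => left; rfl
    | node a u s =>
      right
      simp only [Set.mem_ofPred_eq, size] at ht
      exact ⟨(a, u, s), ⟨trivial, by simp; omega, by simp; omega⟩, rfl⟩

/-- Valid trees with `n` edges. -/
noncomputable def G {d : ℕ} (o : Option (Fin d)) (n : ℕ) : Finset (PT d) :=
  Set.Finite.toFinset (s := {t : PT d | t.Valid o ∧ t.size = n})
    ((finite_size n).subset (fun _ ht => ht.2.le))

lemma mem_G {d : ℕ} {o : Option (Fin d)} {n : ℕ} {t : PT d} :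
    t ∈ G o n ↔ t.Valid o ∧ t.size = n := by
  simp [G]

lemma G_zero {d : ℕ} (o : Option (Fin d)) : G o 0 = {nil} := by
  ext t
  rw [mem_G]
  cases t with
  | nil => simp [Valid, size]
  | node a u s => simp [Valid, size]

lemma sum_G_succ {d : ℕ} (o : Option (Fin d)) (n : ℕ) (f : PT d → ℝ) :
    ∑ t ∈ G o (n + 1), f t = ∑ p ∈ Finset.HasAntidiagonal.antidiagonal n,
      ∑ a ∈ Finset.univ.filter (fun a : Fin d => some a ≠ o),
        ∑ u ∈ G (some a) p.1, ∑ s ∈ G o p.2, f (node a u s) := by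
  simp_rw [Finset.sum_sigma']
  symm
  refine Finset.sum_bij (fun x _ => node x.2.1 x.2.2.1 x.2.2.2) ?_ ?_ ?_ ?_
  · rintro ⟨⟨k, l⟩, a, u, s⟩ h
    simp [mem_G, Valid, size] at h ⊢
    obtain ⟨h1, h2, ⟨h3, h4⟩, h5, h6⟩ := h
    exact ⟨⟨h2, h3, h5⟩, by omega⟩
  · rintro ⟨⟨k, l⟩, a, u, s⟩ h ⟨⟨k', l'⟩, a', u', s'⟩ h' he
    simp [mem_G] at h h' he ⊢
    grind
  · intro t ht
    rw [mem_G] at ht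
    cases t with
    | nil => simp [size] at ht
    | node a u s =>
      simp [Valid, size] at ht
      refine ⟨⟨⟨u.size, s.size⟩, a, u, s⟩, ?_, rfl⟩
      simp [mem_G]
      tauto
  · intros; rfl

/-- Number of valid trees. -/
noncomputable def cnt {d : ℕ} (o : Option (Fin d)) (n : ℕ) : ℝ := ((G o n).card : ℝ)

lemma cnt_eq {d : ℕ} (o : Option (Fin d)) (n : ℕ) : cnt o n = ∑ _t ∈ G o n, (1 : ℝ) := by
  simp [cnt]

/-- Number of coloured plane trees. -/
noncomputable def bb (d n : ℕ) : ℝ := (catalan n : ℝ) * ((d : ℝ) - 1) ^ n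

lemma bb_rec (d n : ℕ) :
    bb d (n + 1) = ((d : ℝ) - 1) * ∑ p ∈ Finset.HasAntidiagonal.antidiagonal n, bb d p.1 * bb d p.2 := by
  unfold bb
  rw [catalan_succ']
  push_cast
  rw [Finset.sum_mul, Finset.mul_sum]
  apply Finset.sum_congr rfl
  rintro ⟨i, j⟩ hij
  have hij' : i + j = n := by simpa using hij
  simp only
  rw [← hij']
  ring

lemma cnt_some {d : ℕ} (a : Fin d) (n : ℕ) : cnt (some a) n = bb d n := by
  induction n using Nat.strong_induction_on generalizing a with
  | _ n ih =>
    rcases n with _ | n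
    · simp [cnt, G_zero, bb]
    · rw [cnt_eq, sum_G_succ, bb_rec, Finset.mul_sum]
      apply Finset.sum_congr rfl
      rintro ⟨i, j⟩ hij
      have hij' : i + j = n := by simpa using hij
      simp only [Finset.sum_const, nsmul_eq_mul, mul_one]
      have h1 : ∀ c : Fin d, ((G (some c) i).card : ℝ) = bb d i := fun c => ih i (by omega) c
      have h2 : ((G (some a) j).card : ℝ) = bb d j := ih j (by omega) a
      simp_rw [h1, h2]
      rw [Finset.sum_const, nsmul_eq_mul]
      congr 1
      have : (Finset.univ.filter (fun c : Fin d => some c ≠ some a)) = Finset.univ.erase a := by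
        ext c; simp
      rw [this, Finset.card_erase_of_mem (Finset.mem_univ _), Finset.card_univ, Fintype.card_fin,
        Nat.cast_sub (by have := a.2; omega)]
      simp

/-- number of available colours at the root -/
noncomputable def col {d : ℕ} (o : Option (Fin d)) : ℝ :=
  ((Finset.univ.filter (fun a : Fin d => some a ≠ o)).card : ℝ)

lemma cnt_rec {d : ℕ} (o : Option (Fin d)) (n : ℕ) :
    cnt o (n + 1) = col o * ∑ p ∈ Finset.HasAntidiagonal.antidiagonal n, bb d p.1 * cnt o p.2 := by
  rw [cnt_eq, sum_G_succ, Finset.mul_sum]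
  apply Finset.sum_congr rfl
  rintro ⟨i, j⟩ hij
  simp only [Finset.sum_const, nsmul_eq_mul, mul_one]
  have : ∀ c : Fin d, ((G (some c) i).card : ℝ) = bb d i := fun c => cnt_some c i
  simp_rw [this]
  rw [Finset.sum_const, nsmul_eq_mul]; rfl

lemma col_none {d : ℕ} : col (none : Option (Fin d)) = d := by
  simp [col]

lemma col_some {d : ℕ} (a : Fin d) : col (some a) = (d : ℝ) - 1 := by
  have : (Finset.univ.filter (fun c : Fin d => some c ≠ some a)) = Finset.univ.erase a := by
    ext c; simp
  rw [col, this, Finset.card_erase_of_mem (Finset.mem_univ _), Finset.card_univ, Fintype.card_fin,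
        Nat.cast_sub (by have := a.2; omega)]
  simp

lemma bb_pos {d : ℕ} (hd : 2 ≤ d) (n : ℕ) : 0 < bb d n := by
  have h2 : (2 : ℝ) ≤ d := by exact_mod_cast hd
  have hc : 0 < catalan n := by
    have h := succ_mul_catalan_eq_centralBinom n
    have := Nat.centralBinom_pos n
    rcases Nat.eq_zero_or_pos (catalan n) with h0 | h0
    · rw [h0] at h; omega
    · exact h0
  unfold bb
  have : (0 : ℝ) < catalan n := by exact_mod_cast hc
  have : (0 : ℝ) < (d : ℝ) - 1 := by linarith
  positivity

lemma cnt_pos {d : ℕ} (hd : 2 ≤ d) (o : Option (Fin d)) (n : ℕ) : 0 < cnt o n := by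
  have h2 : (2 : ℝ) ≤ d := by exact_mod_cast hd
  have hc : 0 < col o := by
    rcases o with _ | a
    · rw [col_none]; linarith
    · rw [col_some]; linarith
  induction n using Nat.strong_induction_on with
  | _ n ih =>
    rcases n with _ | n
    · simp [cnt, G_zero]
    · rw [cnt_rec]
      apply mul_pos hc
      apply Finset.sum_pos
      · rintro ⟨i, j⟩ hij
        have hij' : i + j = n := by simpa using hij
        exact mul_pos (bb_pos hd _) (ih j (by omega))
      · exact ⟨(0, n), by simp⟩

lemma seqHyp {d : ℕ} (hd : 2 ≤ d) : SeqHyp (bb d) (cnt (none : Option (Fin d))) ((d : ℝ) - 1) where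
  hm := by
    have h2 : (2 : ℝ) ≤ d := by exact_mod_cast hd
    linarith
  b0 := by simp [bb]
  W0 := by simp [cnt, G_zero]
  bpos := bb_pos hd
  Wpos := cnt_pos hd none
  hb := bb_rec d
  hW := by
    intro n
    rw [cnt_rec, col_none]; ring
  hc := by
    intro n
    have h1 : ((n + 1 : ℕ) : ℝ) * catalan n = Nat.centralBinom n := by
      exact_mod_cast succ_mul_catalan_eq_centralBinom n
    have h2 : ((n + 1 + 1 : ℕ) : ℝ) * catalan (n + 1) = Nat.centralBinom (n + 1) := by
      exact_mod_cast succ_mul_catalan_eq_centralBinom (n + 1)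
    have h3 : ((n + 1 : ℕ) : ℝ) * Nat.centralBinom (n + 1) =
        2 * (2 * n + 1) * Nat.centralBinom n := by
      exact_mod_cast Nat.succ_mul_centralBinom_succ n
    push_cast at h1 h2 h3
    have h4 : ((n : ℝ) + 2) * catalan (n + 1) = (4 * n + 2) * catalan n := by
      have hn : ((n : ℝ) + 1) ≠ 0 := by positivity
      apply mul_left_cancel₀ hn
      calc ((n : ℝ) + 1) * (((n : ℝ) + 2) * catalan (n + 1))
          = ((n : ℝ) + 1) * (((n : ℝ) + 1 + 1) * catalan (n + 1)) := by ring
        _ = _ := by rw [h2, h3, ← h1]; ring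
    unfold bb
    rw [pow_succ]
    linear_combination ((d : ℝ) - 1) ^ n * ((d : ℝ) - 1) * h4

/-- splitting probabilities for all root types -/
lemma exists_split_all {d : ℕ} (hd : 2 ≤ d) :
    ∃ r : Option (Fin d) → ℕ → ℕ → ℝ, (∀ o k l, 0 ≤ r o k l) ∧ (∀ o k l, r o k l ≤ 1) ∧
      (∀ o l, r o 0 l = 0) ∧ (∀ o k, r o (k + 1) 0 = 1) ∧
      ∀ o k l, r o (k + 1) l * (bb d (k + 1) / bb d k) +
        (1 - r o k (l + 1)) * (cnt o (l + 1) / cnt o l) =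
        cnt o (k + l + 2) / cnt o (k + l + 1) := by
  have H : ∀ o : Option (Fin d), ∃ r : ℕ → ℕ → ℝ, (∀ k l, 0 ≤ r k l) ∧ (∀ k l, r k l ≤ 1) ∧
      (∀ l, r 0 l = 0) ∧ (∀ k, r (k + 1) 0 = 1) ∧
      ∀ k l, r (k + 1) l * (bb d (k + 1) / bb d k) +
        (1 - r k (l + 1)) * (cnt o (l + 1) / cnt o l) =
        cnt o (k + l + 2) / cnt o (k + l + 1) := by
    intro o
    have h := seqHyp hd
    have h2 : (2 : ℝ) ≤ d := by exact_mod_cast hd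
    rcases o with _ | a
    · exact exists_split (bb d) (cnt none) d (by linarith) h.bpos h.Wpos
        (fun n => by rw [cnt_rec, col_none]) (fun k n hkn => h.Wlc hkn) (fun k n hkn => h.cross hkn)
    · have e : cnt (some a) = bb d := funext (cnt_some a)
      rw [e]
      exact exists_split (bb d) (bb d) ((d : ℝ) - 1) (by linarith) h.bpos h.bpos h.hb
        (fun k n hkn => h.blc hkn) (fun k n hkn => h.blc hkn)
  choose r h1 h2 h3 h4 h5 using H
  exact ⟨r, h1, h2, h3, h4, h5⟩

/-- `x` arises from `w` by removing an adjacent equal pair. -/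
def Rem {d : ℕ} (w x : List (Fin d)) : Prop := ∃ p t q, x = p ++ q ∧ w = p ++ t :: t :: q

lemma Rem.ctx {d : ℕ} {w x : List (Fin d)} (h : Rem w x) (l r : List (Fin d)) :
    Rem (l ++ w ++ r) (l ++ x ++ r) := by
  obtain ⟨p, t, q, rfl, rfl⟩ := h
  exact ⟨l ++ p, t, q ++ r, by simp, by simp⟩

/-- The averaging operator of random pair removal. -/
noncomputable def M {d : ℕ} (r : Option (Fin d) → ℕ → ℕ → ℝ) :
    PT d → Option (Fin d) → (PT d → ℝ) → ℝ
  | nil, _, _ => 0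
  | node a u s, o, g => if u.size + s.size = 0 then g nil else
      r o u.size s.size * M r u (some a) (fun u' => g (node a u' s)) +
      (1 - r o u.size s.size) * M r s o (fun s' => g (node a u s'))

lemma M_add {d : ℕ} (r : Option (Fin d) → ℕ → ℕ → ℝ) (w : PT d) (o : Option (Fin d))
    (f g : PT d → ℝ) : M r w o (fun x => f x + g x) = M r w o f + M r w o g := by
  induction w generalizing o f g with
  | nil => simp [M]
  | node a u s hu hs =>
    simp only [M]
    split_ifs
    · rfl
    · rw [hu, hs]; ring

lemma M_mul {d : ℕ} (r : Option (Fin d) → ℕ → ℕ → ℝ) (w : PT d) (o : Option (Fin d)) (c : ℝ)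
    (f : PT d → ℝ) : M r w o (fun x => c * f x) = c * M r w o f := by
  induction w generalizing o f with
  | nil => simp [M]
  | node a u s hu hs =>
    simp only [M]
    split_ifs
    · rfl
    · rw [hu, hs]; ring

lemma M_sum {d : ℕ} (r : Option (Fin d) → ℕ → ℕ → ℝ) (w : PT d) (o : Option (Fin d))
    (S : Finset (PT d)) (f : PT d → PT d → ℝ) :
    M r w o (fun x => ∑ y ∈ S, f y x) = ∑ y ∈ S, M r w o (f y) := by
  induction S using Finset.induction_on with
  | empty =>
    have := M_mul r w o 0 (fun _ => 0)
    simpa using this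
  | insert y S hy ih =>
    simp_rw [Finset.sum_insert hy]
    rw [M_add, ih]

lemma size_eq_zero {d : ℕ} {t : PT d} (h : t.size = 0) : t = nil := by
  cases t with
  | nil => rfl
  | node a u s => simp [size] at h

lemma M_nonneg {d : ℕ} (r : Option (Fin d) → ℕ → ℕ → ℝ) (h0 : ∀ o k l, 0 ≤ r o k l)
    (h1 : ∀ o k l, r o k l ≤ 1) (hz : ∀ o l, r o 0 l = 0) (hl : ∀ o k, r o (k + 1) 0 = 1)
    (w : PT d) (o : Option (Fin d)) (n : ℕ) (hw : w ∈ G o (n + 1)) (g : PT d → ℝ)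
    (hg : ∀ x ∈ G o n, Rem w.wd x.wd → 0 ≤ g x) : 0 ≤ M r w o g := by
  induction w generalizing o g n with
  | nil => simp [M]
  | node a u s hu hs =>
    rw [mem_G] at hw
    simp only [Valid, size] at hw
    obtain ⟨⟨ha, hVu, hVs⟩, hsz⟩ := hw
    simp only [M]
    split_ifs with hc
    · have e1 : u = nil := size_eq_zero (by omega)
      have e2 : s = nil := size_eq_zero (by omega)
      subst e1 e2
      apply hg
      · rw [mem_G]; simp [Valid, size] at hsz ⊢; omega
      · exact ⟨[], a, [], by simp [wd], by simp [wd]⟩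
    · apply add_nonneg
      · rcases hk : u.size with _ | k
        · rw [hz]; simp
        · apply mul_nonneg (h0 _ _ _)
          apply hu (some a) k (by rw [mem_G]; exact ⟨hVu, hk⟩)
          intro x hx hrem
          rw [mem_G] at hx
          apply hg
          · rw [mem_G]; simp only [Valid, size]
            exact ⟨⟨ha, hx.1, hVs⟩, by omega⟩
          · have := hrem.ctx [a] (a :: s.wd)
            simpa [wd] using this
      · rcases hk : s.size with _ | k
        · obtain ⟨j, hj⟩ : ∃ j, u.size = j + 1 := ⟨u.size - 1, by omega⟩
          rw [hj, hl]; simp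
        · apply mul_nonneg (by linarith [h1 o u.size (k + 1)])
          apply hs o k (by rw [mem_G]; exact ⟨hVs, hk⟩)
          intro x hx hrem
          rw [mem_G] at hx
          apply hg
          · rw [mem_G]; simp only [Valid, size]
            exact ⟨⟨ha, hVu, hx.1⟩, by omega⟩
          · have := hrem.ctx (a :: (u.wd ++ [a])) []
            simpa [wd] using this

lemma M_one {d : ℕ} (r : Option (Fin d) → ℕ → ℕ → ℝ)
    (hz : ∀ o l, r o 0 l = 0) (hl : ∀ o k, r o (k + 1) 0 = 1)
    (w : PT d) (o : Option (Fin d)) (hw : w.size ≠ 0) : M r w o (fun _ => 1) = 1 := by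
  induction w generalizing o with
  | nil => simp [size] at hw
  | node a u s hu hs =>
    simp only [M]
    split_ifs with hc
    · rfl
    · rcases hk : u.size with _ | k
      · rw [hz, hs o (by omega)]; simp
      · rw [hu _ (by omega)]
        rcases hk' : s.size with _ | k'
        · rw [hl]; simp
        · rw [hs _ (by omega)]; ring

lemma M_stat {d : ℕ} (hd : 2 ≤ d) (r : Option (Fin d) → ℕ → ℕ → ℝ)
    (hz : ∀ o l, r o 0 l = 0) (hl : ∀ o k, r o (k + 1) 0 = 1)
    (hr : ∀ o k l, r o (k + 1) l * (bb d (k + 1) / bb d k) +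
        (1 - r o k (l + 1)) * (cnt o (l + 1) / cnt o l) =
        cnt o (k + l + 2) / cnt o (k + l + 1))
    (n : ℕ) (o : Option (Fin d)) (g : PT d → ℝ) :
    ∑ w ∈ G o (n + 1), M r w o g = (cnt o (n + 1) / cnt o n) * ∑ x ∈ G o n, g x := by
  induction n using Nat.strong_induction_on generalizing o g with
  | _ n ih =>
    rcases n with _ | n
    · rw [sum_G_succ]
      simp only [G_zero, Finset.Nat.antidiagonal_zero, Finset.sum_singleton, M, size, cnt_rec]
      simp [bb, cnt, col, G_zero]
    · rw [sum_G_succ, sum_G_succ, Finset.mul_sum]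
      have step1 : ∀ p ∈ Finset.HasAntidiagonal.antidiagonal (n + 1),
          (∑ a ∈ Finset.univ.filter (fun a : Fin d => some a ≠ o),
            ∑ u ∈ G (some a) p.1, ∑ s ∈ G o p.2, M r (node a u s) o g) =
          r o p.1 p.2 * (∑ a ∈ Finset.univ.filter (fun a : Fin d => some a ≠ o),
            ∑ s ∈ G o p.2, ∑ u ∈ G (some a) p.1, M r u (some a) (fun u' => g (node a u' s))) +
          (1 - r o p.1 p.2) * (∑ a ∈ Finset.univ.filter (fun a : Fin d => some a ≠ o),
            ∑ u ∈ G (some a) p.1, ∑ s ∈ G o p.2, M r s o (fun s' => g (node a u s'))) := by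
        rintro ⟨k, l⟩ hkl
        have hkl' : k + l = n + 1 := by simpa using hkl
        simp only [Finset.mul_sum, ← Finset.sum_add_distrib]
        apply Finset.sum_congr rfl
        intro a ha
        rw [Finset.sum_comm (s := G o l), ← Finset.sum_add_distrib]
        apply Finset.sum_congr rfl
        intro u hu
        rw [← Finset.sum_add_distrib]
        apply Finset.sum_congr rfl
        intro s hs
        rw [mem_G] at hu hs
        simp only [M]
        rw [if_neg (by omega), hu.2, hs.2]
      rw [Finset.sum_congr rfl step1, Finset.sum_add_distrib]
      rw [Finset.Nat.sum_antidiagonal_succ (f := fun p => r o p.1 p.2 * _)]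
      rw [Finset.Nat.sum_antidiagonal_succ' (f := fun p => (1 - r o p.1 p.2) * _)]
      simp only [hz, hl, zero_mul, sub_self, zero_add]
      rw [← Finset.sum_add_distrib]
      apply Finset.sum_congr rfl
      rintro ⟨k, l⟩ hkl
      have hkl' : k + l = n := by simpa using hkl
      simp only
      simp_rw [ih k (by omega), ih l (by omega), cnt_some, ← Finset.mul_sum]
      have := hr o k l
      rw [← hkl', ← this]
      have e : ∀ a : Fin d, ∑ s ∈ G o l, ∑ u ∈ G (some a) k, g (node a u s) =
        ∑ u ∈ G (some a) k, ∑ s ∈ G o l, g (node a u s) := fun a => Finset.sum_comm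
      simp_rw [e]
      ring

/-- The removal kernel with uniform marginals. -/
lemma exists_kernel {d : ℕ} (hd : 2 ≤ d) :
    ∃ P : PT d → PT d → ℝ, 
      (∀ n, ∀ w ∈ G none (n + 1), ∀ x ∈ G none n, 0 ≤ P w x) ∧
      (∀ n, ∀ w ∈ G none (n + 1), ∀ x ∈ G none n, P w x ≠ 0 → Rem w.wd x.wd) ∧
      (∀ n, ∀ w ∈ G none (n + 1), ∑ x ∈ G none n, P w x = 1) ∧
      (∀ n, ∀ x ∈ G (none : Option (Fin d)) n, ∑ w ∈ G none (n + 1), P w x =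
        cnt (none : Option (Fin d)) (n + 1) / cnt (none : Option (Fin d)) n) := by
  obtain ⟨r, h0, h1, hz, hl, hr⟩ := exists_split_all hd
  refine ⟨fun w x => M r w none (fun y => if x = y then 1 else 0), ?_, ?_, ?_, ?_⟩
  · intro n w hw x hx
    apply M_nonneg r h0 h1 hz hl w none n hw
    intros; split_ifs <;> norm_num
  · intro n w hw x hx hne
    by_contra hrem
    apply hne
    apply le_antisymm
    · have := M_nonneg r h0 h1 hz hl w none n hw (fun y => (-1) * if x = y then 1 else 0) (by
        intro y hy hry
        rw [if_neg (by rintro rfl; exact hrem hry)]; simp)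
      rw [M_mul] at this
      linarith
    · apply M_nonneg r h0 h1 hz hl w none n hw
      intros; split_ifs <;> norm_num
  · intro n w hw
    simp only
    rw [← M_sum]
    have hone := M_one r hz hl w none (by rw [mem_G] at hw; omega)
    have key : ∀ y ∈ G (none : Option (Fin d)) n,
        (∑ x ∈ G (none : Option (Fin d)) n, if x = y then (1 : ℝ) else 0) = 1 := by
      intro y hy
      simp [hy]
    apply le_antisymm
    · have := M_nonneg r h0 h1 hz hl w none n hw (fun y => 1 + (-1) *
        (∑ x ∈ G (none : Option (Fin d)) n, if x = y then (1 : ℝ) else 0)) (by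
        intro y hy _
        rw [key y hy]; simp)
      rw [M_add, M_mul, hone] at this
      linarith
    · have := M_nonneg r h0 h1 hz hl w none n hw (fun y => (-1) * 1 +
        (∑ x ∈ G (none : Option (Fin d)) n, if x = y then (1 : ℝ) else 0)) (by
        intro y hy _
        rw [key y hy]; simp)
      rw [M_add, M_mul, hone] at this
      linarith
  · intro n x hx
    simp only
    rw [M_stat hd r hz hl hr]
    simp [hx]

end PT

section Telescope

lemma jensen2 {α β : Type*} (S : Finset α) (S' : Finset β) (A : α → β → ℝ)
    (h0 : ∀ x ∈ S, ∀ y ∈ S', 0 ≤ A x y) (h1 : ∑ x ∈ S, ∑ y ∈ S', A x y = 1) (h : α → β → ℝ) :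
    (∑ x ∈ S, ∑ y ∈ S', A x y * h x y) ^ 2 ≤ ∑ x ∈ S, ∑ y ∈ S', A x y * h x y ^ 2 := by
  set μ := ∑ x ∈ S, ∑ y ∈ S', A x y * h x y with hμ
  have h2 : 0 ≤ ∑ x ∈ S, ∑ y ∈ S', A x y * (h x y - μ) ^ 2 :=
    Finset.sum_nonneg fun x hx => Finset.sum_nonneg fun y hy =>
      mul_nonneg (h0 x hx y hy) (sq_nonneg _)
  have h3 : ∑ x ∈ S, ∑ y ∈ S', A x y * (h x y - μ) ^ 2 =
      (∑ x ∈ S, ∑ y ∈ S', A x y * h x y ^ 2) - 2 * μ * (∑ x ∈ S, ∑ y ∈ S', A x y * h x y)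
        + μ ^ 2 * ∑ x ∈ S, ∑ y ∈ S', A x y := by
    simp only [Finset.mul_sum, ← Finset.sum_sub_distrib, ← Finset.sum_add_distrib]
    refine Finset.sum_congr rfl fun x _ => Finset.sum_congr rfl fun y _ => by ring
  rw [h1, ← hμ] at h3
  nlinarith

variable {T : Type*} (G : ℕ → Finset T) (P : T → T → ℝ) (n : ℕ)

/-- Iterated kernel: `j` removal steps from level `n`. -/
noncomputable def RA : ℕ → T → T → ℝ
  | 0, w, x => if w = x then 1 else 0
  | j + 1, w, x' => ∑ x ∈ G (n - j), RA j w x * P x x'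

variable {G P n}

lemma RA_props (N : ℕ → ℝ) (Npos : ∀ k, 0 < N k)
    (hP0 : ∀ k, ∀ w ∈ G (k + 1), ∀ x ∈ G k, 0 ≤ P w x)
    (hP1 : ∀ k, ∀ w ∈ G (k + 1), ∑ x ∈ G k, P w x = 1)
    (hP2 : ∀ k, ∀ x ∈ G k, ∑ w ∈ G (k + 1), P w x = N (k + 1) / N k) (j : ℕ) (hj : j ≤ n) :
    (∀ w ∈ G n, ∀ x ∈ G (n - j), 0 ≤ RA G P n j w x) ∧
    (∀ w ∈ G n, ∑ x ∈ G (n - j), RA G P n j w x = 1) ∧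
    (∀ x ∈ G (n - j), ∑ w ∈ G n, RA G P n j w x = N n / N (n - j)) := by
  induction j with
  | zero =>
    refine ⟨?_, ?_, ?_⟩
    · intro w _ x _
      simp only [RA]; split_ifs <;> norm_num
    · intro w hw
      simp [RA, hw]
    · intro x hx
      have hx' : x ∈ G n := hx
      simp [RA, hx', (Npos n).ne']
  | succ j ih =>
    obtain ⟨i0, i1, i2⟩ := ih (by omega)
    obtain ⟨k, hk⟩ : ∃ k, n - j = k + 1 := ⟨n - j - 1, by omega⟩
    have hk' : n - (j + 1) = k := by omega
    rw [hk] at i0 i1 i2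
    simp only [RA, hk, hk']
    refine ⟨?_, ?_, ?_⟩
    · intro w hw x hx
      exact Finset.sum_nonneg fun y hy => mul_nonneg (i0 w hw y hy) (hP0 k y hy x hx)
    · intro w hw
      rw [Finset.sum_comm, ← i1 w hw]
      refine Finset.sum_congr rfl fun y hy => ?_
      rw [← Finset.mul_sum, hP1 k y hy, mul_one]
    · intro x hx
      rw [Finset.sum_comm]
      have : ∀ y ∈ G (k + 1), ∑ w ∈ G n, RA G P n j w y * P y x = N n / N (k + 1) * P y x := by
        intro y hy
        rw [← Finset.sum_mul, i2 y hy]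
      rw [Finset.sum_congr rfl this, ← Finset.mul_sum, hP2 k x hx]
      have := Npos (k + 1)
      field_simp

/-- One telescoping step. -/
lemma tele_step (k l : ℕ) (A B : T → ℝ) (A' B' : T → ℝ) (V E : T → T → ℝ)
    (hP0 : ∀ k, ∀ w ∈ G (k + 1), ∀ x ∈ G k, 0 ≤ P w x)
    (hP1 : ∀ k, ∀ w ∈ G (k + 1), ∑ x ∈ G k, P w x = 1)
    (hE : ∀ x ∈ G (k + 1), ∀ x' ∈ G k, ∀ y' ∈ G (l + 1), ∀ y ∈ G l, P x x' ≠ 0 → P y' y ≠ 0 →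
      (V x y - V x' y') ^ 2 ≤ E x' y)
    (hA0 : ∀ x ∈ G (k + 1), 0 ≤ A x) (hB0 : ∀ y ∈ G (l + 1), 0 ≤ B y)
    (hA1 : ∑ x ∈ G (k + 1), A x = 1) (hB1 : ∑ y ∈ G (l + 1), B y = 1)
    (hA' : ∀ x', A' x' = ∑ x ∈ G (k + 1), A x * P x x')
    (hB' : ∀ y, B' y = ∑ y' ∈ G (l + 1), B y' * P y' y) :
    ((∑ x ∈ G (k + 1), ∑ y ∈ G l, A x * B' y * V x y) -
      (∑ x' ∈ G k, ∑ y' ∈ G (l + 1), A' x' * B y' * V x' y')) ^ 2 ≤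
    ∑ x' ∈ G k, ∑ y ∈ G l, A' x' * B' y * E x' y := by
  have e1 : (∑ x ∈ G (k + 1), ∑ y ∈ G l, A x * B' y * V x y) =
      ∑ x ∈ G (k + 1), ∑ x' ∈ G k, (A x * P x x') *
        ∑ y' ∈ G (l + 1), ∑ y ∈ G l, (B y' * P y' y) * V x y := by
    refine Finset.sum_congr rfl fun x hx => ?_
    rw [← Finset.sum_mul, ← Finset.mul_sum, hP1 k x hx, mul_one, Finset.sum_comm, Finset.mul_sum]
    refine Finset.sum_congr rfl fun y hy => ?_
    rw [← Finset.sum_mul, ← hB']; ring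
  have e2 : (∑ x' ∈ G k, ∑ y' ∈ G (l + 1), A' x' * B y' * V x' y') =
      ∑ x ∈ G (k + 1), ∑ x' ∈ G k, (A x * P x x') *
        ∑ y' ∈ G (l + 1), ∑ y ∈ G l, (B y' * P y' y) * V x' y' := by
    rw [Finset.sum_comm]
    rw [Finset.sum_comm (s := G (k + 1))]
    rw [Finset.sum_comm]
    refine Finset.sum_congr rfl fun x' hx' => ?_
    rw [← Finset.sum_mul, ← hA', Finset.mul_sum]
    refine Finset.sum_congr rfl fun y' hy' => ?_
    rw [← Finset.sum_mul, ← Finset.mul_sum, hP1 l y' hy']; ring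
  have e3 : ∑ x' ∈ G k, ∑ y ∈ G l, A' x' * B' y * E x' y =
      ∑ x ∈ G (k + 1), ∑ x' ∈ G k, (A x * P x x') *
        ∑ y' ∈ G (l + 1), ∑ y ∈ G l, (B y' * P y' y) * E x' y := by
    rw [Finset.sum_comm (s := G (k + 1))]
    refine Finset.sum_congr rfl fun x' hx' => ?_
    rw [← Finset.sum_mul, ← hA', Finset.sum_comm, Finset.mul_sum]
    refine Finset.sum_congr rfl fun y hy => ?_
    rw [← Finset.sum_mul, ← hB']; ring
  have hA2 : ∑ x ∈ G (k + 1), ∑ x' ∈ G k, A x * P x x' = 1 := by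
    rw [← hA1]
    refine Finset.sum_congr rfl fun x hx => ?_
    rw [← Finset.mul_sum, hP1 k x hx, mul_one]
  have hB2 : ∑ x ∈ G (l + 1), ∑ x' ∈ G l, B x * P x x' = 1 := by
    rw [← hB1]
    refine Finset.sum_congr rfl fun x hx => ?_
    rw [← Finset.mul_sum, hP1 l x hx, mul_one]
  have hA3 : ∀ x ∈ G (k + 1), ∀ x' ∈ G k, 0 ≤ A x * P x x' := fun x hx x' hx' =>
    mul_nonneg (hA0 x hx) (hP0 k x hx x' hx')
  have hB3 : ∀ x ∈ G (l + 1), ∀ x' ∈ G l, 0 ≤ B x * P x x' := fun x hx x' hx' =>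
    mul_nonneg (hB0 x hx) (hP0 l x hx x' hx')
  rw [e1, e2, e3]
  have e4 : (∑ x ∈ G (k + 1), ∑ x' ∈ G k, (A x * P x x') *
        ∑ y' ∈ G (l + 1), ∑ y ∈ G l, (B y' * P y' y) * V x y) -
      (∑ x ∈ G (k + 1), ∑ x' ∈ G k, (A x * P x x') *
        ∑ y' ∈ G (l + 1), ∑ y ∈ G l, (B y' * P y' y) * V x' y') =
      ∑ x ∈ G (k + 1), ∑ x' ∈ G k, (A x * P x x') *
        ∑ y' ∈ G (l + 1), ∑ y ∈ G l, (B y' * P y' y) * (V x y - V x' y') := by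
    simp only [mul_sub, Finset.sum_sub_distrib]
  rw [e4]
  refine (jensen2 _ _ _ hA3 hA2 _).trans ?_
  refine Finset.sum_le_sum fun x hx => Finset.sum_le_sum fun x' hx' => ?_
  by_cases hp : P x x' = 0
  · simp [hp]
  refine mul_le_mul_of_nonneg_left ?_ (hA3 x hx x' hx')
  refine (jensen2 _ _ _ hB3 hB2 _).trans ?_
  refine Finset.sum_le_sum fun y' hy' => Finset.sum_le_sum fun y hy => ?_
  by_cases hq : P y' y = 0
  · simp [hq]
  exact mul_le_mul_of_nonneg_left (hE x hx x' hx' y' hy' y hy hp hq) (hB3 y' hy' y hy)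

lemma telescope (N : ℕ → ℝ) (Npos : ∀ k, 0 < N k)
    (hP0 : ∀ k, ∀ w ∈ G (k + 1), ∀ x ∈ G k, 0 ≤ P w x)
    (hP1 : ∀ k, ∀ w ∈ G (k + 1), ∑ x ∈ G k, P w x = 1)
    (hP2 : ∀ k, ∀ x ∈ G k, ∑ w ∈ G (k + 1), P w x = N (k + 1) / N k)
    (nl : T) (G0 : G 0 = {nl}) (V E : T → T → ℝ)
    (hE : ∀ k l, k + l + 1 = n → ∀ x ∈ G (k + 1), ∀ x' ∈ G k, ∀ y' ∈ G (l + 1), ∀ y ∈ G l,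
      P x x' ≠ 0 → P y' y ≠ 0 → (V x y - V x' y') ^ 2 ≤ E x' y) :
    ∑ w ∈ G n, ∑ z ∈ G n, (V w nl - V nl z) ^ 2 ≤
      n * ∑ k ∈ Finset.range n, (N n / N k) * (N n / N (n - 1 - k)) *
        ∑ x ∈ G k, ∑ y ∈ G (n - 1 - k), E x y := by
  have props := fun j hj => RA_props (n := n) N Npos hP0 hP1 hP2 j hj
  set R : ℕ → T → T → ℝ := fun k => RA G P n (n - k) with hR
  have r0 : ∀ k ≤ n, ∀ w ∈ G n, ∀ x ∈ G k, 0 ≤ R k w x := by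
    intro k hk
    have := (props (n - k) (by omega)).1
    rwa [show n - (n - k) = k by omega] at this
  have r1 : ∀ k ≤ n, ∀ w ∈ G n, ∑ x ∈ G k, R k w x = 1 := by
    intro k hk
    have := (props (n - k) (by omega)).2.1
    rwa [show n - (n - k) = k by omega] at this
  have r2 : ∀ k ≤ n, ∀ x ∈ G k, ∑ w ∈ G n, R k w x = N n / N k := by
    intro k hk
    have := (props (n - k) (by omega)).2.2
    rwa [show n - (n - k) = k by omega] at this
  have rs : ∀ k < n, ∀ w x', R k w x' = ∑ x ∈ G (k + 1), R (k + 1) w x * P x x' := by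
    intro k hk w x'
    simp only [hR]
    rw [show n - k = (n - (k + 1)) + 1 by omega, RA, show n - (n - (k + 1)) = k + 1 by omega]
  set F : ℕ → T → T → ℝ := fun k w z => ∑ x ∈ G k, ∑ y ∈ G (n - k), R k w x * R (n - k) z y * V x y
    with hF
  have Rn : ∀ w x, R n w x = if w = x then 1 else 0 := by
    intro w x
    simp only [hR, Nat.sub_self, RA]
  have R0 : ∀ w ∈ G n, R 0 w nl = 1 := by
    intro w hw
    have := r1 0 (by omega) w hw
    rwa [G0, Finset.sum_singleton] at this
  have Fn : ∀ w ∈ G n, ∀ z ∈ G n, F n w z = V w nl := by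
    intro w hw z hz
    simp only [hF, Nat.sub_self, G0, Finset.sum_singleton, R0 z hz, Rn]
    simp [hw]
  have F0 : ∀ w ∈ G n, ∀ z ∈ G n, F 0 w z = V nl z := by
    intro w hw z hz
    simp only [hF, Nat.sub_zero, G0, Finset.sum_singleton, R0 w hw, Rn]
    simp [hz]
  have main : ∀ w ∈ G n, ∀ z ∈ G n, (V w nl - V nl z) ^ 2 ≤
      n * ∑ k ∈ Finset.range n, ∑ x ∈ G k, ∑ y ∈ G (n - 1 - k),
        R k w x * R (n - 1 - k) z y * E x y := by
    intro w hw z hz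
    rw [← Fn w hw z hz, ← F0 w hw z hz, ← Finset.sum_range_sub (fun k => F k w z)]
    refine (sq_sum_le_card_mul_sum_sq).trans ?_
    rw [Finset.card_range]
    refine mul_le_mul_of_nonneg_left ?_ (by positivity)
    refine Finset.sum_le_sum fun k hk => ?_
    have hk' : k < n := by simpa using hk
    obtain ⟨l, hl⟩ : ∃ l, k + l + 1 = n := ⟨n - 1 - k, by omega⟩
    simp only [hF]
    rw [show n - (k + 1) = l by omega, show n - k = l + 1 by omega, show n - 1 - k = l by omega]
    exact tele_step k l (R (k + 1) w) (R (l + 1) z) (R k w) (R l z) V E hP0 hP1 (hE k l hl)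
      (r0 (k + 1) (by omega) w hw) (r0 (l + 1) (by omega) z hz)
      (r1 (k + 1) (by omega) w hw) (r1 (l + 1) (by omega) z hz)
      (rs k hk' w) (rs l (by omega) z)
  refine (Finset.sum_le_sum fun w hw => Finset.sum_le_sum fun z hz => main w hw z hz).trans ?_
  simp only [← Finset.mul_sum]
  refine mul_le_mul_of_nonneg_left (le_of_eq ?_) (by positivity)
  have : ∀ w ∈ G n, ∑ z ∈ G n, ∑ k ∈ Finset.range n, ∑ x ∈ G k, ∑ y ∈ G (n - 1 - k),
        R k w x * R (n - 1 - k) z y * E x y = ∑ k ∈ Finset.range n, ∑ x ∈ G k, 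
        R k w x * ∑ y ∈ G (n - 1 - k), (N n / N (n - 1 - k)) * E x y := by
    intro w hw
    rw [Finset.sum_comm]
    refine Finset.sum_congr rfl fun k hk => ?_
    rw [Finset.sum_comm]
    refine Finset.sum_congr rfl fun x hx => ?_
    rw [Finset.sum_comm, Finset.mul_sum]
    refine Finset.sum_congr rfl fun y hy => ?_
    rw [← r2 (n - 1 - k) (by omega) y hy, Finset.sum_mul, Finset.mul_sum]
    refine Finset.sum_congr rfl fun z hz => by ring
  rw [Finset.sum_congr rfl this, Finset.sum_comm]
  refine Finset.sum_congr rfl fun k hk => ?_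
  have hk' : k < n := by simpa using hk
  rw [Finset.sum_comm, Finset.mul_sum]
  refine Finset.sum_congr rfl fun x hx => ?_
  rw [← Finset.sum_mul, r2 k hk'.le x hx, ← Finset.mul_sum]
  ring

end Telescope

namespace PT

lemma wd_inj_some {d : ℕ} (u : PT d) : ∀ (u' : PT d) (a : Fin d) (r r' : List (Fin d)),
    u.Valid (some a) → u'.Valid (some a) → u.wd ++ a :: r = u'.wd ++ a :: r' →
    u = u' ∧ r = r' := by
  induction u with
  | nil =>
    intro u' a r r' _ h' he
    cases u' with
    | nil => simpa [wd] using he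
    | node b u1 s1 =>
      simp [wd, Valid] at he h'
      exact absurd he.1.symm h'.1
  | node b u1 s1 hu hs =>
    intro u' a r r' h h' he
    cases u' with
    | nil =>
      simp [wd, Valid] at he h
      exact absurd he.1 h.1
    | node c u2 s2 =>
      simp only [Valid] at h h'
      simp only [wd, List.cons_append, List.append_assoc, List.cons.injEq] at he
      obtain ⟨rfl, he⟩ := he
      obtain ⟨e1, he2⟩ := hu u2 b _ _ h.2.1 h'.2.1 he
      obtain ⟨e2, he3⟩ := hs s2 a _ _ h.2.2 h'.2.2 he2
      exact ⟨by rw [e1, e2], he3⟩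

lemma wd_inj {d : ℕ} (t : PT d) : ∀ t' : PT d, t.Valid none → t'.Valid none →
    t.wd = t'.wd → t = t' := by
  induction t with
  | nil =>
    intro t' _ _ he
    cases t' with
    | nil => rfl
    | node b u1 s1 => simp [wd] at he
  | node b u s hu hs =>
    intro t' h h' he
    cases t' with
    | nil => simp [wd] at he
    | node c u2 s2 =>
      simp only [Valid] at h h'
      simp only [wd, List.cons.injEq] at he
      obtain ⟨rfl, he⟩ := he
      obtain ⟨e1, he2⟩ := wd_inj_some u u2 b _ _ h.2.1 h'.2.1 he
      rw [e1, hs s2 h.2.2 h'.2.2 he2]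

lemma parse_some {d : ℕ} (m : ℕ) : ∀ (l : List (Fin d)), l.length ≤ m → ∀ (a : Fin d)
    (st : List (Fin d)), l.foldl redStep (a :: st) = [] →
    ∃ (u : PT d) (l' : List (Fin d)), u.Valid (some a) ∧ l = u.wd ++ a :: l' ∧
      l'.foldl redStep st = [] := by
  induction m with
  | zero =>
    intro l hl a st h
    have : l = [] := by simpa using hl
    subst this
    simp at h
  | succ m ih =>
    intro l hl a st h
    cases l with
    | nil => simp at h
    | cons c l1 =>
      simp only [List.length_cons] at hl
      by_cases hc : c = a
      · subst hc
        refine ⟨nil, l1, by simp [Valid], by simp [wd], ?_⟩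
        simpa [redStep] using h
      · have h' : l1.foldl redStep (c :: a :: st) = [] := by
          simpa [redStep, hc] using h
        obtain ⟨u1, l2, v1, rfl, h2⟩ := ih l1 (by omega) c _ h'
        simp only [List.length_append, List.length_cons] at hl
        obtain ⟨s, l3, v2, rfl, h3⟩ := ih l2 (by omega) a _ h2
        refine ⟨node c u1 s, l3, ?_, by simp [wd], h3⟩
        simp [Valid, hc, v1, v2]

lemma parse {d : ℕ} (m : ℕ) : ∀ (l : List (Fin d)), l.length ≤ m → l.foldl redStep [] = [] →
    ∃ u : PT d, u.Valid none ∧ l = u.wd := by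
  induction m with
  | zero =>
    intro l hl h
    have : l = [] := by simpa using hl
    exact ⟨nil, by simp [Valid], by simp [this, wd]⟩
  | succ m ih =>
    intro l hl h
    cases l with
    | nil => exact ⟨nil, by simp [Valid], by simp [wd]⟩
    | cons c l1 =>
      have h' : l1.foldl redStep [c] = [] := by simpa [redStep] using h
      obtain ⟨u, l2, v1, rfl, h2⟩ := parse_some _ l1 le_rfl c _ h'
      simp only [List.length_append, List.length_cons] at hl
      obtain ⟨s, v2, rfl⟩ := ih l2 (by omega) h2
      exact ⟨node c u s, by simp [Valid, v1, v2], by simp [wd]⟩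

lemma fully_parse {d n : ℕ} (w : Fin (2 * n) → Fin d) (h : FullyReducible w) :
    ∃ t ∈ G (none : Option (Fin d)) n, t.wd = List.ofFn w := by
  unfold FullyReducible irrOf at h
  rw [List.reverse_eq_nil_iff] at h
  obtain ⟨t, ht, e⟩ := parse _ _ le_rfl h
  refine ⟨t, ?_, e.symm⟩
  rw [mem_G]
  refine ⟨ht, ?_⟩
  have := length_wd t
  rw [← e, List.length_ofFn] at this
  omega

end PT

section Edges

/-- Insert a pair. -/
def insP {d : ℕ} (j : ℕ) (t : Fin d) (z : List (Fin d)) : List (Fin d) :=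
  z.take j ++ t :: t :: z.drop j

/-- Read a list as a word. -/
def toW {d : ℕ} (a0 : Fin d) (N : ℕ) (l : List (Fin d)) : Fin N → Fin d := fun i => l.getD i a0

lemma toW_ofFn {d N : ℕ} (a0 : Fin d) (w : Fin N → Fin d) : toW a0 N (List.ofFn w) = w := by
  funext i
  simp [toW]

lemma ofFn_toW {d N : ℕ} (a0 : Fin d) (l : List (Fin d)) (h : l.length = N) :
    List.ofFn (toW a0 N l) = l := by
  subst h
  apply List.ext_getElem
  · simp
  · intro i h1 h2
    simp [toW, h2]

lemma length_insP {d : ℕ} (j : ℕ) (t : Fin d) (z : List (Fin d)) :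
    (insP j t z).length = z.length + 2 := by
  simp [insP]; omega

lemma insP_inj {d : ℕ} {j : ℕ} {t : Fin d} {z z' : List (Fin d)} (hj : j ≤ z.length)
    (hj' : j ≤ z'.length) (h : insP j t z = insP j t z') : z = z' := by
  unfold insP at h
  have h1 := List.append_inj h (by simp [hj, hj'])
  have h2 : z.drop j = z'.drop j := by simpa using h1.2
  rw [← List.take_append_drop j z, ← List.take_append_drop j z', h1.1, h2]

lemma insP_step {d : ℕ} (j : ℕ) (z : List (Fin d)) (hj : j < z.length) :
    insP j z[j] z = insP (j + 1) z[j] z := by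
  unfold insP
  have e := List.drop_eq_getElem_cons hj
  rw [List.take_succ_eq_append_getElem hj, List.append_assoc]
  simp only [List.singleton_append]
  congr 1
  rw [e]

lemma hasPair_insP {d N : ℕ} (a0 : Fin d) (j : ℕ) (t : Fin d) (z : List (Fin d))
    (hj : j ≤ z.length) : hasPair (toW a0 N (insP j t z)) j t := by
  intro p hp
  simp only [toW, insP]
  rcases hp with hp | hp
  · rw [hp, List.getD_append_right _ _ _ _ (by simp)]
    simp [hj]
  · rw [hp, List.getD_append_right _ _ _ _ (by simp only [List.length_take]; omega)]
    simp [hj]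

lemma flipAt_insP {d N : ℕ} (a0 : Fin d) (j : ℕ) (t a : Fin d) (z : List (Fin d))
    (hj : j ≤ z.length) : flipAt (toW a0 N (insP j t z)) j a = toW a0 N (insP j a z) := by
  funext p
  by_cases hp : (p : ℕ) = j ∨ (p : ℕ) = j + 1
  · rw [hasPair_insP a0 j a z hj p hp]
    simp [flipAt, hp]
  · simp only [flipAt, hp, if_false, toW, insP]
    rcases Nat.lt_or_ge p j with h | h
    · rw [List.getD_append _ _ _ _ (by simp; omega), List.getD_append _ _ _ _ (by simp; omega)]
    · rw [List.getD_append_right _ _ _ _ (by simp; omega),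
        List.getD_append_right _ _ _ _ (by simp; omega)]
      obtain ⟨q, hq⟩ : ∃ q, (p : ℕ) - (z.take j).length = q + 2 :=
        ⟨p - j - 2, by simp; omega⟩
      rw [hq]
      simp

/-- Local energy of inserting a pair into `z`. -/
noncomputable def locE {d : ℕ} (V : List (Fin d) → ℝ) (L : ℕ) (z : List (Fin d)) : ℝ :=
  ∑ j ∈ Finset.range (L + 1), ∑ t : Fin d, ∑ a : Fin d, (V (insP j t z) - V (insP j a z)) ^ 2

lemma locE_nonneg {d : ℕ} (V : List (Fin d) → ℝ) (L : ℕ) (z : List (Fin d)) : 0 ≤ locE V L z := by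
  unfold locE; positivity

lemma path_bound {A : Type*} [Fintype A] (φ : ℕ → A → ℝ) (L : ℕ)
    (hc : ∀ j < L, ∃ c, φ j c = φ (j + 1) c) (i j : ℕ) (hi : i ≤ L) (hj : j ≤ L) (t s : A) :
    (φ i t - φ j s) ^ 2 ≤ ((L : ℝ) + 1) *
      ∑ j ∈ Finset.range (L + 1), ∑ t : A, ∑ a : A, (φ j t - φ j a) ^ 2 := by
  set D : ℕ → ℝ := fun j => ∑ t : A, ∑ a : A, (φ j t - φ j a) ^ 2 with hD
  have D0 : ∀ j, 0 ≤ D j := fun j => by simp only [hD]; positivity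
  have Dle : ∀ j t a, |φ j t - φ j a| ≤ √(D j) := by
    intro j t a
    apply Real.abs_le_sqrt
    have h1 : (φ j t - φ j a) ^ 2 ≤ ∑ a : A, (φ j t - φ j a) ^ 2 :=
      Finset.single_le_sum (f := fun a => (φ j t - φ j a) ^ 2)
        (fun _ _ => sq_nonneg _) (Finset.mem_univ a)
    have h2 : ∑ a : A, (φ j t - φ j a) ^ 2 ≤ D j :=
      Finset.single_le_sum (f := fun t => ∑ a : A, (φ j t - φ j a) ^ 2)
        (fun _ _ => Finset.sum_nonneg fun _ _ => sq_nonneg _) (Finset.mem_univ t)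
    exact h1.trans h2
  have key : ∀ m i, i + m ≤ L → ∀ t s, |φ i t - φ (i + m) s| ≤
      ∑ j ∈ Finset.Icc i (i + m), √(D j) := by
    intro m
    induction m with
    | zero => intro i _ t s; simpa using Dle i t s
    | succ m ih =>
      intro i him t s
      obtain ⟨c, hcc⟩ := hc (i + m) (by omega)
      have h1 := ih i (by omega) t c
      have h2 := Dle (i + m + 1) c s
      rw [← add_assoc, Finset.sum_Icc_succ_top (by omega)]
      rw [hcc] at h1
      have := abs_sub_le (φ i t) (φ (i + m + 1) c) (φ (i + m + 1) s)
      linarith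
  have key2 : ∀ i j, i ≤ j → j ≤ L → ∀ t s, |φ i t - φ j s| ≤
      ∑ j ∈ Finset.range (L + 1), √(D j) := by
    intro i j hij hjL t s
    obtain ⟨m, rfl⟩ := Nat.exists_eq_add_of_le hij
    refine (key m i hjL t s).trans ?_
    apply Finset.sum_le_sum_of_subset_of_nonneg
    · intro x hx; simp at hx ⊢; omega
    · intros; positivity
  have key3 : |φ i t - φ j s| ≤ ∑ j ∈ Finset.range (L + 1), √(D j) := by
    rcases le_total i j with h | h
    · exact key2 i j h hj t s
    · rw [abs_sub_comm]; exact key2 j i h hi s t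
  have h4 : (φ i t - φ j s) ^ 2 ≤ (∑ j ∈ Finset.range (L + 1), √(D j)) ^ 2 := by
    rw [← sq_abs]
    exact pow_le_pow_left₀ (abs_nonneg _) key3 2
  refine h4.trans (sq_sum_le_card_mul_sum_sq.trans (le_of_eq ?_))
  rw [Finset.card_range]
  push_cast
  congr 1
  exact Finset.sum_congr rfl fun j _ => Real.sq_sqrt (D0 j)

lemma rem_bound {d : ℕ} (V : List (Fin d) → ℝ) (z w w' : List (Fin d)) (h : PT.Rem w z)
    (h' : PT.Rem w' z) : (V w - V w') ^ 2 ≤ ((z.length : ℝ) + 1) * locE V z.length z := by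
  have aux : ∀ w, PT.Rem w z → ∃ i t, i ≤ z.length ∧ w = insP i t z := by
    rintro w ⟨p, t, q, rfl, rfl⟩
    exact ⟨p.length, t, by simp, by simp [insP]⟩
  obtain ⟨i, t, hi, rfl⟩ := aux w h
  obtain ⟨j, s, hj, rfl⟩ := aux w' h'
  exact path_bound (fun j t => V (insP j t z)) z.length
    (fun j hj => ⟨z[j], congrArg V (insP_step j z hj)⟩) i j hi hj t s

lemma sum_locE {d n : ℕ} (a0 : Fin d) (v : (Fin (2 * n + 2) → Fin d) → ℝ) :
    ∑ z : Fin (2 * n) → Fin d, locE (fun l => v (toW a0 (2 * n + 2) l)) (2 * n) (List.ofFn z) ≤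
      2 * quadForm d (2 * n + 2) v := by
  set V : List (Fin d) → ℝ := fun l => v (toW a0 (2 * n + 2) l) with hV
  unfold locE quadForm
  rw [Finset.sum_comm, Finset.mul_sum, show 2 * n + 2 - 1 = 2 * n + 1 by omega]
  refine Finset.sum_le_sum fun j hj => ?_
  have hj' : j ≤ 2 * n := by simp at hj; omega
  set X : Fin d → Fin d → ℝ := fun t a =>
    ∑ z : Fin (2 * n) → Fin d, (V (insP j t (List.ofFn z)) - V (insP j a (List.ofFn z))) ^ 2 with hX
  set Y : Fin d → Fin d → ℝ := fun t a => ∑ w : Fin (2 * n + 2) → Fin d,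
        if hasPair w j t then (v w - v (flipAt w j a)) ^ 2 else 0 with hY
  have hXY : ∀ t a, X t a ≤ Y t a := by
    intro t a
    simp only [hX, hY]
    rw [← Finset.sum_filter]
    have inj : Function.Injective
        (fun z : Fin (2 * n) → Fin d => toW a0 (2 * n + 2) (insP j t (List.ofFn z))) := by
      intro z z' h
      simp only at h
      have h2 := congrArg List.ofFn h
      rw [ofFn_toW _ _ (by simp [length_insP]), ofFn_toW _ _ (by simp [length_insP])] at h2
      exact List.ofFn_injective (insP_inj (by simpa using hj') (by simpa using hj') h2)
    have e : ∑ z : Fin (2 * n) → Fin d,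
        (V (insP j t (List.ofFn z)) - V (insP j a (List.ofFn z))) ^ 2 =
        ∑ w ∈ Finset.univ.image
          (fun z : Fin (2 * n) → Fin d => toW a0 (2 * n + 2) (insP j t (List.ofFn z))),
          (v w - v (flipAt w j a)) ^ 2 := by
      rw [Finset.sum_image (fun _ _ _ _ h => inj h)]
      refine Finset.sum_congr rfl fun z _ => ?_
      rw [flipAt_insP a0 j t a _ (by simpa using hj')]
    rw [e]
    apply Finset.sum_le_sum_of_subset_of_nonneg
    · intro w hw
      simp only [Finset.mem_image, Finset.mem_univ, true_and] at hw
      obtain ⟨z, rfl⟩ := hw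
      simp only [Finset.mem_filter, Finset.mem_univ, true_and]
      exact hasPair_insP a0 j t _ (by simpa using hj')
    · intros; positivity
  have hsym : ∀ t a, X t a = X a t := by
    intro t a
    simp only [hX]
    exact Finset.sum_congr rfl fun z _ => by ring
  have hdiag : ∀ t, X t t = 0 := by intro t; simp [hX]
  have hsplit : ∑ t, ∑ a, X t a = 2 * ∑ t, ∑ a, if t < a then X t a else 0 := by
    have e1 : ∀ t a, X t a = (if t < a then X t a else 0) + (if a < t then X a t else 0) := by
      intro t a
      rcases lt_trichotomy t a with h | h | h
      · simp [h, h.le]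
      · subst h; simp [hdiag]
      · simp [h, h.le, hsym t a]
    calc ∑ t, ∑ a, X t a = ∑ t, ∑ a, ((if t < a then X t a else 0) + (if a < t then X a t else 0)) :=
          Finset.sum_congr rfl fun t _ => Finset.sum_congr rfl fun a _ => e1 t a
      _ = (∑ t, ∑ a, if t < a then X t a else 0) + ∑ t, ∑ a, if a < t then X a t else 0 := by
          simp only [Finset.sum_add_distrib]
      _ = _ := by
          rw [Finset.sum_comm (f := fun t a => if a < t then X a t else 0)]; ring
  have e0 : ∑ z : Fin (2 * n) → Fin d, ∑ t : Fin d, ∑ a : Fin d,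
      (V (insP j t (List.ofFn z)) - V (insP j a (List.ofFn z))) ^ 2 = ∑ t, ∑ a, X t a := by
    rw [Finset.sum_comm]
    refine Finset.sum_congr rfl fun t _ => ?_
    rw [Finset.sum_comm]
  rw [e0, hsplit]
  refine mul_le_mul_of_nonneg_left ?_ (by norm_num)
  refine Finset.sum_le_sum fun t _ => Finset.sum_le_sum fun a _ => ?_
  split_ifs
  · exact hXY t a
  · exact le_refl _

lemma sum_pairs_le {d n k l : ℕ} (a0 : Fin d) (hkl : k + l = n) (D : List (Fin d) → ℝ)
    (hD : ∀ z, 0 ≤ D z) :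
    ∑ x ∈ PT.G (none : Option (Fin d)) k, ∑ y ∈ PT.G (none : Option (Fin d)) l,
      D (x.wd ++ y.wd) ≤ ∑ z : Fin (2 * n) → Fin d, D (List.ofFn z) := by
  rw [← Finset.sum_product']
  have len : ∀ p ∈ PT.G (none : Option (Fin d)) k ×ˢ PT.G (none : Option (Fin d)) l,
      (p.1.wd ++ p.2.wd).length = 2 * n := by
    rintro ⟨x, y⟩ hp
    simp only [Finset.mem_product, PT.mem_G] at hp
    simp only [List.length_append, PT.length_wd]
    omega
  have e : ∑ p ∈ PT.G (none : Option (Fin d)) k ×ˢ PT.G (none : Option (Fin d)) l,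
      D (p.1.wd ++ p.2.wd) = ∑ z ∈ (PT.G (none : Option (Fin d)) k ×ˢ
        PT.G (none : Option (Fin d)) l).image (fun p => toW a0 (2 * n) (p.1.wd ++ p.2.wd)),
        D (List.ofFn z) := by
    rw [Finset.sum_image]
    · refine Finset.sum_congr rfl fun p hp => ?_
      rw [ofFn_toW _ _ (len p hp)]
    · rintro ⟨x, y⟩ hp ⟨x', y'⟩ hp' h
      have h2 := congrArg List.ofFn h
      rw [ofFn_toW _ _ (len _ hp), ofFn_toW _ _ (len _ hp')] at h2
      simp only [Finset.coe_product, Set.mem_prod, Finset.mem_coe, PT.mem_G] at hp hp'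
      have h3 := List.append_inj h2 (by simp only [PT.length_wd]; omega)
      rw [PT.wd_inj x x' hp.1.1 hp'.1.1 h3.1, PT.wd_inj y y' hp.2.1 hp'.2.1 h3.2]
  rw [e]
  exact Finset.sum_le_sum_of_subset_of_nonneg (Finset.subset_univ _) (fun _ _ _ => hD _)

end Edges


lemma variance_le {ι : Type*} (s : Finset ι) (f : ι → ℝ) :
    ∃ c : ℝ, 2 * (s.card : ℝ) * ∑ t ∈ s, (f t - c) ^ 2 = ∑ w ∈ s, ∑ z ∈ s, (f w - f z) ^ 2 := by
  rcases s.eq_empty_or_nonempty with h | h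
  · exact ⟨0, by simp [h]⟩
  have hN : (s.card : ℝ) ≠ 0 := by exact_mod_cast h.card_pos.ne'
  refine ⟨(∑ t ∈ s, f t) / s.card, ?_⟩
  have e1 : ∑ w ∈ s, ∑ z ∈ s, (f w - f z) ^ 2 =
      2 * (s.card : ℝ) * ∑ t ∈ s, f t ^ 2 - 2 * (∑ t ∈ s, f t) ^ 2 := by
    have : ∀ w z, (f w - f z) ^ 2 = f w ^ 2 - 2 * (f w * f z) + f z ^ 2 := fun w z => by ring
    simp only [this, Finset.sum_add_distrib, Finset.sum_sub_distrib, ← Finset.mul_sum,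
      Finset.sum_const, nsmul_eq_mul]
    rw [← Finset.sum_mul]
    ring
  have e2 : ∀ c : ℝ, ∑ t ∈ s, (f t - c) ^ 2 =
      ∑ t ∈ s, f t ^ 2 - 2 * c * ∑ t ∈ s, f t + s.card * c ^ 2 := by
    intro c
    have : ∀ w, (f w - c) ^ 2 = f w ^ 2 - 2 * c * f w + c ^ 2 := fun w => by ring
    simp only [this, Finset.sum_add_distrib, Finset.sum_sub_distrib, ← Finset.mul_sum,
      Finset.sum_const, nsmul_eq_mul]
  rw [e1, e2]
  field_simp
  ring

lemma fr_le {d n : ℕ} (a0 : Fin d) (v : (Fin (2 * n) → Fin d) → ℝ)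
    (h0 : ∀ w : Fin (2 * n) → Fin d, ¬ FullyReducible w → v w = 0)
    (h1 : (∑ w : Fin (2 * n) → Fin d, (if FullyReducible w then v w else 0)) = 0) (c : ℝ) :
    ∑ w : Fin (2 * n) → Fin d, (v w) ^ 2 ≤
      ∑ t ∈ PT.G (none : Option (Fin d)) n, (v (toW a0 (2 * n) t.wd) - c) ^ 2 := by
  set F := Finset.univ.filter (fun w : Fin (2 * n) → Fin d => FullyReducible w) with hF
  have h1' : ∑ w ∈ F, v w = 0 := by rw [hF, Finset.sum_filter]; exact h1
  have e1 : ∑ w : Fin (2 * n) → Fin d, (v w) ^ 2 = ∑ w ∈ F, (v w) ^ 2 := by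
    symm
    apply Finset.sum_subset (Finset.subset_univ _)
    intro w _ hw
    have : ¬ FullyReducible w := by simpa [hF] using hw
    rw [h0 w this]; norm_num
  have e2 : ∑ w ∈ F, (v w - c) ^ 2 = ∑ w ∈ F, (v w) ^ 2 + F.card * c ^ 2 := by
    have : ∀ w, (v w - c) ^ 2 = v w ^ 2 - 2 * c * v w + c ^ 2 := fun w => by ring
    simp only [this, Finset.sum_add_distrib, Finset.sum_sub_distrib, ← Finset.mul_sum,
      Finset.sum_const, nsmul_eq_mul, h1']
    ring
  have e3 : ∑ w ∈ F, (v w) ^ 2 ≤ ∑ w ∈ F, (v w - c) ^ 2 := by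
    rw [e2]
    have : 0 ≤ (F.card : ℝ) * c ^ 2 := by positivity
    linarith
  rw [e1]
  refine e3.trans ?_
  have hsub : F ⊆ (PT.G (none : Option (Fin d)) n).image (fun t => toW a0 (2 * n) t.wd) := by
    intro w hw
    have hw' : FullyReducible w := by simpa [hF] using hw
    obtain ⟨t, ht, e⟩ := PT.fully_parse w hw'
    rw [Finset.mem_image]
    exact ⟨t, ht, by rw [e, toW_ofFn]⟩
  refine (Finset.sum_le_sum_of_subset_of_nonneg hsub (fun _ _ _ => sq_nonneg _)).trans ?_
  rw [Finset.sum_image]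
  intro x hx y hy h
  simp only [Finset.mem_coe, PT.mem_G] at hx hy
  have h2 := congrArg List.ofFn h
  rw [ofFn_toW _ _ (by rw [PT.length_wd, hx.2]), ofFn_toW _ _ (by rw [PT.length_wd, hy.2])] at h2
  exact PT.wd_inj x y hx.1 hy.1 h2

lemma quadForm_nonneg {d N : ℕ} (v : (Fin N → Fin d) → ℝ) : 0 ≤ quadForm d N v := by
  unfold quadForm
  refine Finset.sum_nonneg fun i _ => Finset.sum_nonneg fun t _ => Finset.sum_nonneg fun a _ => ?_
  split_ifs
  · refine Finset.sum_nonneg fun w _ => ?_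
    split_ifs
    · positivity
    · exact le_refl _
  · exact le_refl _

lemma ratio_le {b W : ℕ → ℝ} {m : ℝ} (h : SeqHyp b W m) (n k l : ℕ) (e : k + l = n) :
    W (n + 1) / (W k * W l) ≤ 4 * m * ((n : ℝ) + 1) ^ 4 := by
  have hm : 0 < m := by linarith [h.hm]
  have hk := h.Wpos k
  have hl := h.Wpos l
  rw [div_le_iff₀ (by positivity)]
  have a1 := h.upper (n + 1)
  have a2 := h.Wlower k
  have a3 := h.Wlower l
  have hkn : (k : ℝ) ≤ n := by exact_mod_cast (by omega : k ≤ n)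
  have hln : (l : ℝ) ≤ n := by exact_mod_cast (by omega : l ≤ n)
  have b2 : (4 * m) ^ k ≤ ((n : ℝ) + 1) ^ 2 * W k := a2.trans (by gcongr)
  have b3 : (4 * m) ^ l ≤ ((n : ℝ) + 1) ^ 2 * W l := a3.trans (by gcongr)
  calc W (n + 1) ≤ (4 * m) ^ (n + 1) := a1
    _ = 4 * m * ((4 * m) ^ k * (4 * m) ^ l) := by rw [← e]; ring
    _ ≤ 4 * m * ((((n : ℝ) + 1) ^ 2 * W k) * (((n : ℝ) + 1) ^ 2 * W l)) := by gcongr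
    _ = _ := by ring

lemma main_bound {d n : ℕ} (hd : 3 ≤ d) (v : (Fin (2 * n + 2) → Fin d) → ℝ)
    (h0 : ∀ w : Fin (2 * n + 2) → Fin d, ¬ FullyReducible w → v w = 0)
    (h1 : (∑ w : Fin (2 * n + 2) → Fin d, (if FullyReducible w then v w else 0)) = 0) :
    ∑ w : Fin (2 * n + 2) → Fin d, (v w) ^ 2 ≤
      8 * d * ((n : ℝ) + 1) ^ 7 * quadForm d (2 * n + 2) v := by
  have hd2 : 2 ≤ d := by omega
  have a0 : Fin d := ⟨0, by omega⟩
  set Q := quadForm d (2 * n + 2) v with hQ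
  have Q0 : 0 ≤ Q := quadForm_nonneg v
  obtain ⟨P, hP0, hPR, hP1, hP2⟩ := PT.exists_kernel hd2
  set W : ℕ → ℝ := PT.cnt (none : Option (Fin d)) with hW
  have Wpos : ∀ k, 0 < W k := PT.cnt_pos hd2 none
  set V : List (Fin d) → ℝ := fun l => v (toW a0 (2 * n + 2) l) with hV
  have tel := telescope (n := n + 1) (G := PT.G (none : Option (Fin d))) (P := P) W Wpos hP0 hP1 hP2
    PT.nil (PT.G_zero none) (fun x y => V (x.wd ++ y.wd))
    (fun x y => (2 * (n : ℝ) + 1) * locE V (2 * n) (x.wd ++ y.wd)) (by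
      intro k l hkl x hx x' hx' y' hy' y hy hxx hyy
      have r1 := (hPR k x hx x' hx' hxx).ctx [] y.wd
      have r2 := (hPR l y' hy' y hy hyy).ctx x'.wd []
      simp only [List.nil_append, List.append_nil] at r1 r2
      have := rem_bound V _ _ _ r1 r2
      have len : (x'.wd ++ y.wd).length = 2 * n := by
        rw [PT.mem_G] at hx' hy
        rw [List.length_append, PT.length_wd, PT.length_wd, hx'.2, hy.2]
        omega
      rw [len] at this
      push_cast at this
      exact this)
  simp only [PT.wd, List.nil_append, List.append_nil, Nat.add_sub_cancel] at tel
  obtain ⟨c, hc⟩ := variance_le (PT.G (none : Option (Fin d)) (n + 1)) (fun t => V t.wd)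
  rw [← hc] at tel
  have hfr := fr_le (n := n + 1) a0 v h0 h1 c
  have hS : ∀ k ∈ Finset.range (n + 1), W (n + 1) / W k * (W (n + 1) / W (n - k)) *
      ∑ x ∈ PT.G (none : Option (Fin d)) k, ∑ y ∈ PT.G (none : Option (Fin d)) (n - k),
        (2 * (n : ℝ) + 1) * locE V (2 * n) (x.wd ++ y.wd) ≤
      W (n + 1) * (4 * d * ((n : ℝ) + 1) ^ 4 * ((2 * (n : ℝ) + 1) * (2 * Q))) := by
    intro k hk
    have hk' : k + (n - k) = n := by simp at hk; omega
    simp only [← Finset.mul_sum]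
    have s1 := sum_pairs_le a0 hk' (fun z => locE V (2 * n) z) (fun z => locE_nonneg _ _ _)
    have s2 := s1.trans (sum_locE a0 v)
    have r := ratio_le (PT.seqHyp hd2) n k (n - k) hk'
    have r' : W (n + 1) / (W k * W (n - k)) ≤ 4 * d * ((n : ℝ) + 1) ^ 4 := by
      refine r.trans ?_
      gcongr
      linarith
    have p1 := Wpos (n + 1)
    have p2 := Wpos k
    have p3 := Wpos (n - k)
    have e : W (n + 1) / W k * (W (n + 1) / W (n - k)) =
        W (n + 1) * (W (n + 1) / (W k * W (n - k))) := by field_simp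
    rw [e, mul_assoc]
    refine mul_le_mul_of_nonneg_left ?_ p1.le
    refine mul_le_mul r' ?_ ?_ (by positivity)
    · exact mul_le_mul_of_nonneg_left s2 (by positivity)
    · refine mul_nonneg (by positivity) ?_
      exact Finset.sum_nonneg fun _ _ => Finset.sum_nonneg fun _ _ => locE_nonneg _ _ _
  have hS2 := Finset.sum_le_sum hS
  rw [Finset.sum_const, Finset.card_range, nsmul_eq_mul] at hS2
  set S := ∑ t ∈ PT.G (none : Option (Fin d)) (n + 1), (V t.wd - c) ^ 2 with hSd
  have p1 := Wpos (n + 1)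
  have hcard : ((PT.G (none : Option (Fin d)) (n + 1)).card : ℝ) = W (n + 1) := rfl
  rw [hcard] at tel
  have t2 : 2 * W (n + 1) * S ≤ ((n : ℝ) + 1) * (((n : ℝ) + 1) *
      (W (n + 1) * (4 * d * ((n : ℝ) + 1) ^ 4 * ((2 * (n : ℝ) + 1) * (2 * Q))))) := by
    push_cast at tel hS2
    exact tel.trans (mul_le_mul_of_nonneg_left hS2 (by positivity))
  have t3 : W (n + 1) * S ≤ W (n + 1) * (4 * d * ((n : ℝ) + 1) ^ 6 * ((2 * (n : ℝ) + 1) * Q)) := by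
    linarith
  have t4 := le_of_mul_le_mul_left t3 p1
  refine hfr.trans (t4.trans ?_)
  calc 4 * d * ((n : ℝ) + 1) ^ 6 * ((2 * (n : ℝ) + 1) * Q)
      ≤ 4 * d * ((n : ℝ) + 1) ^ 6 * ((2 * ((n : ℝ) + 1)) * Q) := by gcongr; linarith
    _ = _ := by ring

/-- the spectral gap of the pair-flip Hamiltonian restricted to the
fully reducible subspace is `Ω(1/(n^{15/2} d))`. -/
theorem pf_gap_lower_fully_reducible :
    ∃ c : ℝ, 0 < c ∧ ∀ d : ℕ, 3 ≤ d → ∀ n : ℕ, 1 ≤ n →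
      ∀ v : (Fin (2 * n) → Fin d) → ℝ,
        (∀ w : Fin (2 * n) → Fin d, ¬ FullyReducible w → v w = 0) →
        (∑ w : Fin (2 * n) → Fin d, (if FullyReducible w then v w else 0)) = 0 →
        quadForm d (2 * n) v ≥
          (c / ((d : ℝ) * (n : ℝ) ^ ((15 : ℝ) / 2))) *
            ∑ w : Fin (2 * n) → Fin d, (v w) ^ 2 := by
  refine ⟨1 / 8, by norm_num, ?_⟩
  intro d hd n hn v h0 h1
  obtain ⟨n, rfl⟩ : ∃ n', n = n' + 1 := ⟨n - 1, by omega⟩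
  have hb := main_bound (n := n) hd v h0 h1
  have Q0 : 0 ≤ quadForm d (2 * (n + 1)) v := quadForm_nonneg v
  have hdr : (0 : ℝ) < d := by exact_mod_cast (by omega : 0 < d)
  have hx : (1 : ℝ) ≤ ((n + 1 : ℕ) : ℝ) := by push_cast; linarith [Nat.cast_nonneg (α := ℝ) n]
  have hp : (((n + 1 : ℕ) : ℝ)) ^ 7 ≤ ((n + 1 : ℕ) : ℝ) ^ ((15 : ℝ) / 2) := by
    rw [← Real.rpow_natCast]
    exact Real.rpow_le_rpow_of_exponent_le hx (by norm_num)
  have hpos : (0 : ℝ) < ((n + 1 : ℕ) : ℝ) ^ ((15 : ℝ) / 2) := Real.rpow_pos_of_pos (by linarith) _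
  set R := ((n + 1 : ℕ) : ℝ) ^ ((15 : ℝ) / 2) with hR
  have hcast : ((n + 1 : ℕ) : ℝ) = (n : ℝ) + 1 := by push_cast; ring
  rw [hcast] at hp
  have hb2 : ∑ w : Fin (2 * (n + 1)) → Fin d, (v w) ^ 2 ≤
      8 * d * R * quadForm d (2 * (n + 1)) v := by
    refine le_trans hb ?_
    refine mul_le_mul_of_nonneg_right ?_ Q0
    exact mul_le_mul_of_nonneg_left hp (by positivity)
  rw [ge_iff_le, div_mul_eq_mul_div, div_le_iff₀ (by positivity)]
  linarith
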